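/- Let $\mathcal{L}$ be a regular language over a finite alphabet $\Sigma$. Then $\mathcal{L}$ is sparse if and only if $\mathcal{L}$ is a finite union of languages of the form $v_1 w_1^* v_2 w_2^* \cdots v_s w_s^* v_{s+1}$, where $s \ge 0$, the $v_i$ are possibly empty words over $\Sigma$, and the $w_i$ are nonempty words over $\Sigma$. -/

import Mathlib

/-- `wordPow w n` is the `n`-fold concatenation `w^n` of the word `w`. -/
def wordPow {α : Type*} (w : List α) (n : ℕ) : List α :=
  (List.replicate n w).flatten

/-- The language `{v₀ w₁^{n₁} v₁ w₂^{n₂} ⋯ v_{s-1} w_s^{n_s} v_s : n₁, …, n_s ≥ 0}`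
(here `v` is indexed by `0, …, s` and `w` by `1, …, s`). -/
def patternLang {α : Type*} (s : ℕ) (v w : ℕ → List α) : Language α :=
  { x | ∃ n : ℕ → ℕ,
      x = v 0 ++ ((List.range s).map fun i => wordPow (w (i + 1)) (n (i + 1)) ++ v (i + 1)).flatten }

/-- A language over a finite alphabet is sparse if its counting function
`f(n) = #{w ∈ L : |w| ≤ n}` is `O(n^e)` for some natural number `e`. -/
def IsSparseLang {α : Type*} (L : Language α) : Prop :=
  ∃ e C N : ℕ, ∀ n ≥ N, {w ∈ L | w.length ≤ n}.ncard ≤ C * n ^ e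

open Filter
open scoped Computability

section WordPow

variable {α : Type*}

theorem wordPow_succ (w : List α) (n : ℕ) : wordPow w (n + 1) = w ++ wordPow w n := by
  simp [wordPow, List.replicate_succ]

theorem length_wordPow (w : List α) (n : ℕ) : (wordPow w n).length = n * w.length := by
  simp [wordPow]

theorem mem_kstar_singleton {w x : List α} :
    x ∈ ({w} : Language α)∗ ↔ ∃ n, x = wordPow w n := by
  rw [Language.mem_kstar]
  constructor
  · rintro ⟨S, rfl, hS⟩
    exact ⟨S.length, congrArg List.flatten (List.eq_replicate_of_mem hS)⟩
  · rintro ⟨n, rfl⟩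
    exact ⟨List.replicate n w, rfl, fun y hy => List.eq_of_mem_replicate hy⟩

theorem flatten_map_injective {ι : Type*} {f : ι → List α} {l : ℕ} (hf : f.Injective)
    (hl : ∀ i, (f i).length = l) {s t : List ι} (hst : s.length = t.length)
    (h : (s.map f).flatten = (t.map f).flatten) : s = t := by
  induction s generalizing t with
  | nil => exact (List.length_eq_zero_iff.1 hst.symm).symm
  | cons a s ih =>
    cases t with
    | nil => simp at hst
    | cons b t =>
      simp only [List.map_cons, List.flatten_cons] at h
      obtain ⟨hab, hst'⟩ := List.append_inj h (by rw [hl, hl])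
      rw [hf hab, ih (by simpa using hst) hst']

end WordPow

section Pattern

variable {α : Type*}

theorem patternLang_zero (v w : ℕ → List α) : patternLang 0 v w = {v 0} := by
  ext x
  change (∃ _ : ℕ → ℕ, _) ↔ x = v 0
  simp

theorem mem_patternLang_succ {s : ℕ} {v w : ℕ → List α} {x : List α} :
    x ∈ patternLang (s + 1) v w ↔ ∃ k, ∃ y ∈ patternLang s (fun i => v (i + 1))
      (fun i => w (i + 1)), x = v 0 ++ (wordPow (w 1) k ++ y) := by
  constructor
  · rintro ⟨n, rfl⟩
    refine ⟨n 1, _, ⟨fun i => n (i + 1), rfl⟩, ?_⟩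
    simp [List.range_succ_eq_map, Function.comp_def]
  · rintro ⟨k, _, ⟨n, rfl⟩, rfl⟩
    refine ⟨fun i => if i = 1 then k else n (i - 1), ?_⟩
    simp [List.range_succ_eq_map, Function.comp_def]

/-- A language of the form `v₁ w₁* v₂ w₂* ⋯ v_s w_s* v_{s+1}` with all `w_i` nonempty. -/
def IsPattern (P : Language α) : Prop :=
  ∃ (s : ℕ) (v w : ℕ → List α), (∀ i, 1 ≤ i → i ≤ s → w i ≠ []) ∧ P = patternLang s v w

/-- A finite union of pattern languages. -/
def IsPatternUnion (K : Language α) : Prop :=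
  ∃ F : Set (Language α), F.Finite ∧ (∀ P ∈ F, IsPattern P) ∧ ∀ x, x ∈ K ↔ ∃ P ∈ F, x ∈ P

theorem IsPattern.singleton (u : List α) : IsPattern ({u} : Language α) :=
  ⟨0, fun _ => u, fun _ => u, fun i h₁ h₂ => by omega, (patternLang_zero (fun _ => u) _).symm⟩

theorem IsPattern.singleton_mul (u : List α) {P : Language α} (hP : IsPattern P) :
    IsPattern ({u} * P) := by
  obtain ⟨s, v, w, hw, rfl⟩ := hP
  refine ⟨s, fun i => if i = 0 then u ++ v 0 else v i, w, hw, ?_⟩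
  ext x
  rw [Language.mem_mul]
  constructor
  · rintro ⟨_, rfl, _, ⟨n, rfl⟩, rfl⟩
    exact ⟨n, by simp⟩
  · rintro ⟨n, rfl⟩
    exact ⟨u, rfl, _, ⟨n, rfl⟩, by simp⟩

theorem IsPattern.kstar_mul {u : List α} (hu : u ≠ []) {P : Language α} (hP : IsPattern P) :
    IsPattern (({u} : Language α)∗ * P) := by
  obtain ⟨s, v, w, hw, rfl⟩ := hP
  refine ⟨s + 1, fun i => if i = 0 then [] else v (i - 1),
    fun i => if i = 1 then u else w (i - 1), ?_, ?_⟩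
  · intro i h₁ h₂
    by_cases h : i = 1
    · simpa [h] using hu
    · simpa [h] using hw (i - 1) (by omega) (by omega)
  · ext x
    rw [Language.mem_mul, mem_patternLang_succ]
    simp only [mem_kstar_singleton, Nat.add_eq_zero_iff, one_ne_zero, and_false, if_false,
      Nat.add_sub_cancel, if_true, List.nil_append]
    constructor
    · rintro ⟨_, ⟨k, rfl⟩, y, hy, rfl⟩
      exact ⟨k, y, hy, rfl⟩
    · rintro ⟨k, y, hy, rfl⟩
      exact ⟨_, ⟨k, rfl⟩, y, hy, rfl⟩

theorem IsPattern.isPatternUnion {P : Language α} (hP : IsPattern P) : IsPatternUnion P :=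
  ⟨{P}, Set.finite_singleton P, by rintro _ rfl; exact hP, by simp⟩

theorem IsPatternUnion.zero : IsPatternUnion (0 : Language α) :=
  ⟨∅, Set.finite_empty, by simp, by simp [Language.notMem_zero]⟩

theorem IsPatternUnion.add {K₁ K₂ : Language α} (h₁ : IsPatternUnion K₁)
    (h₂ : IsPatternUnion K₂) : IsPatternUnion (K₁ + K₂) := by
  obtain ⟨F₁, hF₁, hp₁, hm₁⟩ := h₁
  obtain ⟨F₂, hF₂, hp₂, hm₂⟩ := h₂
  refine ⟨F₁ ∪ F₂, hF₁.union hF₂, ?_, fun x => ?_⟩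
  · rintro P (h | h)
    exacts [hp₁ P h, hp₂ P h]
  · simp only [Language.mem_add, hm₁, hm₂, Set.mem_union, or_and_right, exists_or]

theorem IsPatternUnion.sum {ι : Type*} (s : Finset ι) {K : ι → Language α}
    (h : ∀ i, IsPatternUnion (K i)) : IsPatternUnion (∑ i ∈ s, K i) :=
  Finset.sum_induction K IsPatternUnion (fun _ _ => IsPatternUnion.add) .zero fun i _ => h i

theorem Language.mem_sum {ι : Type*} {s : Finset ι} {K : ι → Language α} {x : List α} :
    x ∈ ∑ i ∈ s, K i ↔ ∃ i ∈ s, x ∈ K i := by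
  classical
  induction s using Finset.induction_on with
  | empty => simp [Language.notMem_zero]
  | insert a s ha ih =>
    rw [Finset.sum_insert ha, Language.mem_add, ih]
    simp only [Finset.mem_insert, or_and_right, exists_or, exists_eq_left]

theorem IsPatternUnion.mul_left {A K : Language α} (hA : ∀ P, IsPattern P → IsPattern (A * P))
    (hK : IsPatternUnion K) : IsPatternUnion (A * K) := by
  obtain ⟨F, hF, hp, hm⟩ := hK
  refine ⟨(A * ·) '' F, hF.image _, ?_, fun x => ?_⟩
  · rintro _ ⟨P, hP, rfl⟩
    exact hA P (hp P hP)
  · simp only [Language.mem_mul, Set.exists_mem_image, hm]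
    constructor
    · rintro ⟨a, ha, b, ⟨P, hP, hb⟩, rfl⟩
      exact ⟨P, hP, a, ha, b, hb, rfl⟩
    · rintro ⟨P, hP, a, ha, b, hb, rfl⟩
      exact ⟨a, ha, b, ⟨P, hP, hb⟩, rfl⟩

theorem IsPatternUnion.kstar_mul (u : List α) {K : Language α} (hK : IsPatternUnion K) :
    IsPatternUnion (({u} : Language α)∗ * K) := by
  by_cases hu : u = []
  · have h : ({u} : Language α)∗ = 1 := by
      ext x
      simp [mem_kstar_singleton, hu, wordPow, Language.mem_one]
    rwa [h, one_mul]
  · exact hK.mul_left fun P hP => hP.kstar_mul hu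

theorem isPatternUnion_iff {L : Language α} :
    IsPatternUnion L ↔ ∃ (m : ℕ) (f : Fin m → Language α), (∀ j, IsPattern (f j)) ∧
      ∀ x, x ∈ L ↔ ∃ j, x ∈ f j := by
  constructor
  · rintro ⟨F, hF, hp, hm⟩
    obtain ⟨n, f, -, rfl⟩ := hF.fin_param
    exact ⟨n, f, fun j => hp _ ⟨j, rfl⟩, fun x => by simp [hm]⟩
  · rintro ⟨m, f, hf, hm⟩
    exact ⟨Set.range f, Set.finite_range f, by rintro _ ⟨j, rfl⟩; exact hf j,
      fun x => by simp [hm]⟩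

end Pattern

section Sparse

variable {α : Type*}

theorem IsSparseLang.zero : IsSparseLang (0 : Language α) :=
  ⟨0, 0, 0, fun n _ => by simp [Language.notMem_zero]⟩

theorem IsSparseLang.add {L₁ L₂ : Language α} (h₁ : IsSparseLang L₁) (h₂ : IsSparseLang L₂) :
    IsSparseLang (L₁ + L₂) := by
  obtain ⟨e₁, C₁, N₁, h₁⟩ := h₁
  obtain ⟨e₂, C₂, N₂, h₂⟩ := h₂
  refine ⟨e₁ + e₂, C₁ + C₂, N₁ + N₂ + 1, fun n hn => ?_⟩
  have heq : {w ∈ L₁ + L₂ | w.length ≤ n} =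
      {w ∈ L₁ | w.length ≤ n} ∪ {w ∈ L₂ | w.length ≤ n} := by
    ext w
    simp only [Set.mem_ofPred_eq, Set.mem_union, Language.mem_add, or_and_right]
  calc _ ≤ C₁ * n ^ e₁ + C₂ * n ^ e₂ := by
        rw [heq]
        exact (Set.ncard_union_le _ _).trans
          (add_le_add (h₁ n (by omega)) (h₂ n (by omega)))
    _ ≤ C₁ * n ^ (e₁ + e₂) + C₂ * n ^ (e₁ + e₂) := by
        gcongr <;> omega
    _ = _ := by ring

variable [Finite α]

theorem finite_mem_length_le (L : Language α) (n : ℕ) : {w ∈ L | w.length ≤ n}.Finite :=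
  (List.finite_length_le α n).subset fun _ h => h.2

theorem ncard_patternLang_le (s : ℕ) {v w : ℕ → List α}
    (hw : ∀ i, 1 ≤ i → i ≤ s → w i ≠ []) (n : ℕ) :
    {x ∈ patternLang s v w | x.length ≤ n}.ncard ≤ (n + 1) ^ s := by
  induction s generalizing v w with
  | zero =>
    rw [patternLang_zero, pow_zero, Set.ncard_le_one (finite_mem_length_le _ n)]
    rintro a ⟨rfl, -⟩ b ⟨rfl, -⟩
    rfl
  | succ s ih =>
    set B : Set (List α) := {x ∈ patternLang s (fun i => v (i + 1)) (fun i => w (i + 1)) |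
      x.length ≤ n}
    have hB : B.ncard ≤ (n + 1) ^ s := ih fun i h₁ h₂ => hw (i + 1) (by omega) (by omega)
    have hBf : B.Finite := finite_mem_length_le _ n
    have hsub : {x ∈ patternLang (s + 1) v w | x.length ≤ n} ⊆
        (fun p : ℕ × List α => v 0 ++ (wordPow (w 1) p.1 ++ p.2)) '' (Set.Iic n ×ˢ B) := by
      rintro x ⟨hx, hlen⟩
      obtain ⟨k, y, hy, rfl⟩ := mem_patternLang_succ.1 hx
      simp only [List.length_append, length_wordPow] at hlen
      have hk : k ≤ k * (w 1).length :=
        Nat.le_mul_of_pos_right k (List.length_pos_iff.2 (hw 1 le_rfl (by omega)))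
      have hyn : y.length ≤ n := by omega
      exact ⟨(k, y), ⟨Set.mem_Iic.2 (by omega), hy, hyn⟩, rfl⟩
    have hfin : (Set.Iic n ×ˢ B).Finite := (Set.finite_Iic n).prod hBf
    calc _ ≤ (Set.Iic n ×ˢ B).ncard :=
          (Set.ncard_le_ncard hsub (hfin.image _)).trans (Set.ncard_image_le hfin)
      _ = (n + 1) * B.ncard := by
          rw [Set.ncard_prod, ← Finset.coe_Iic, Set.ncard_coe_finset, Nat.card_Iic]
      _ ≤ (n + 1) * (n + 1) ^ s := by gcongr
      _ = _ := by ring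

theorem IsPattern.isSparseLang {P : Language α} (hP : IsPattern P) : IsSparseLang P := by
  obtain ⟨s, v, w, hw, rfl⟩ := hP
  refine ⟨s, 2 ^ s, 1, fun n hn => (ncard_patternLang_le s hw n).trans ?_⟩
  rw [← mul_pow]
  gcongr
  omega

theorem IsPatternUnion.isSparseLang {L : Language α} (hL : IsPatternUnion L) :
    IsSparseLang L := by
  obtain ⟨m, f, hf, hm⟩ := isPatternUnion_iff.1 hL
  have h : L = ∑ j, f j := by
    ext x
    simp [Language.mem_sum, hm]
  rw [h]
  exact Finset.sum_induction f IsSparseLang (fun _ _ => IsSparseLang.add) .zero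
    fun j _ => (hf j).isSparseLang

theorem exists_mul_pow_lt_two_pow (C e c l N : ℕ) :
    ∃ k ≥ N, C * (c + k * l) ^ e < 2 ^ k := by
  have h := tendsto_pow_const_div_const_pow_of_one_lt e (one_lt_two : (1 : ℝ) < 2)
  have hpos : (0 : ℝ) < 1 / (C * (c + l) ^ e + 1) := by positivity
  obtain ⟨k, hk, hk1, hkN⟩ :=
    ((h.eventually_lt_const hpos).and ((eventually_ge_atTop 1).and (eventually_ge_atTop N))).exists
  refine ⟨k, hkN, ?_⟩
  rw [div_lt_div_iff₀ (by positivity) (by positivity), one_mul] at hk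
  have hk' : k ^ e * (C * (c + l) ^ e + 1) < 2 ^ k := by exact_mod_cast hk
  calc C * (c + k * l) ^ e ≤ C * (k * (c + l)) ^ e := by
        gcongr
        nlinarith
    _ ≤ k ^ e * (C * (c + l) ^ e + 1) := by
        rw [mul_pow]
        nlinarith [Nat.zero_le (k ^ e)]
    _ < 2 ^ k := hk'

theorem IsSparseLang.append_comm {L : Language α} (hL : IsSparseLang L) {x y u v : List α}
    (h : ∀ z ∈ ({u, v} : Language α)∗, x ++ z ++ y ∈ L) : u ++ v = v ++ u := by
  by_contra hne
  obtain ⟨e, C, N, hL⟩ := hL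
  set l := (u ++ v).length with hl
  have hl0 : 0 < l := by
    rw [hl, List.length_pos_iff]
    rintro h₀
    obtain ⟨rfl, rfl⟩ := List.append_eq_nil_iff.1 h₀
    exact hne rfl
  obtain ⟨k, hkN, hk⟩ := exists_mul_pow_lt_two_pow C e (x.length + y.length) l N
  let f : Bool → List α := fun b => if b then u ++ v else v ++ u
  have hf : f.Injective := by
    intro a b hab
    cases a <;> cases b <;> simp_all [f]
  have hfl : ∀ b, (f b).length = l := by
    intro b
    cases b <;> simp [f, hl, add_comm]
  have hkl : k ≤ k * l := Nat.le_mul_of_pos_right k hl0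
  refine (hL (x.length + y.length + k * l) (by omega)).not_gt (hk.trans_le ?_)
  let g : (Fin k → Bool) → List α := fun b => x ++ ((List.ofFn b).map f).flatten ++ y
  have hg : g.Injective := by
    intro a b hab
    simp only [g, List.append_cancel_right_eq, List.append_cancel_left_eq] at hab
    exact List.ofFn_injective (flatten_map_injective hf hfl (by simp) hab)
  have hcard : (Set.range g).ncard = 2 ^ k := by
    rw [← Set.image_univ, Set.ncard_image_of_injective _ hg, Set.ncard_univ]
    simp
  rw [← hcard]
  refine Set.ncard_le_ncard ?_ (finite_mem_length_le _ _)
  rintro _ ⟨b, rfl⟩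
  have hlen : ∀ s : List Bool, (s.map f).flatten.length = s.length * l := by
    intro s
    induction s with
    | nil => simp
    | cons a s ih =>
      rw [List.map_cons, List.flatten_cons, List.length_append, ih, hfl, List.length_cons]
      ring
  have hmem : ∀ s : List Bool, (s.map f).flatten ∈ ({u, v} : Language α)∗ := by
    intro s
    rw [Language.mem_kstar]
    refine ⟨(s.map fun b => if b then [u, v] else [v, u]).flatten, ?_, ?_⟩
    · induction s with
      | nil => rfl
      | cons a s ih => cases a <;> simp [f, ih]
    · intro z hz
      simp only [List.mem_flatten, List.mem_map] at hz
      obtain ⟨_, ⟨a, -, rfl⟩, hz⟩ := hz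
      change z = u ∨ z = v
      cases a
      · simpa [or_comm] using hz
      · simpa using hz
  refine ⟨h _ (hmem _), ?_⟩
  simp only [g, List.length_append, hlen, List.length_ofFn]
  omega

end Sparse

namespace DFA

variable {α σ : Type*} (M : DFA α σ)

/-- If any two loops at a state commute, then all of them are powers of the shortest one. -/
theorem exists_forall_loop_eq_wordPow {q : σ}
    (hcomm : ∀ u v, M.evalFrom q u = q → M.evalFrom q v = q → u ++ v = v ++ u) :
    ∃ w, M.evalFrom q w = q ∧ ∀ u, M.evalFrom q u = q → ∃ n, u = wordPow w n := by
  by_cases hne : ∃ u, M.evalFrom q u = q ∧ u ≠ []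
  · obtain ⟨w, ⟨hw, hw0⟩, hmin⟩ := exists_minimalFor_of_wellFoundedLT
      (fun u => M.evalFrom q u = q ∧ u ≠ []) List.length hne
    refine ⟨w, hw, fun u => ?_⟩
    induction hn : u.length using Nat.strong_induction_on generalizing u with
    | _ n ih =>
      intro hu
      by_cases hu0 : u = []
      · exact ⟨0, hu0⟩
      have hle : w.length ≤ u.length := by
        by_contra! hlt
        exact hlt.not_ge (hmin ⟨hu, hu0⟩ hlt.le)
      have hpre : w <+: u := List.prefix_of_prefix_length_le (l₃ := w ++ u)
        (List.prefix_append w u) (hcomm w u hw hu ▸ List.prefix_append u w) hle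
      obtain ⟨t, rfl⟩ := hpre
      rw [evalFrom_of_append, hw] at hu
      have hwpos := List.length_pos_iff.2 hw0
      obtain ⟨m, rfl⟩ := ih t.length (by simp at hn; omega) t rfl hu
      exact ⟨m + 1, (wordPow_succ w m).symm⟩
  · push Not at hne
    exact ⟨[], rfl, fun u hu => ⟨0, hne u hu⟩⟩

/-- Splitting a run at its last visit to the initial state. -/
theorem exists_eq_append_last_visit (q : σ) (x : List α) :
    ∃ u y, x = u ++ y ∧ M.evalFrom q u = q ∧
      ∀ p, p <+: y → p ≠ [] → M.evalFrom q p ≠ q := by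
  induction hn : x.length using Nat.strong_induction_on generalizing x with
  | _ n ih =>
    by_cases h : ∃ p, p <+: x ∧ p ≠ [] ∧ M.evalFrom q p = q
    · obtain ⟨p, ⟨t, rfl⟩, hp0, hp⟩ := h
      have hpos := List.length_pos_iff.2 hp0
      obtain ⟨u, y, rfl, hu, hy⟩ := ih t.length (by simp at hn; omega) t rfl
      exact ⟨p ++ u, y, by simp, by rw [evalFrom_of_append, hp, hu], hy⟩
    · push Not at h
      exact ⟨[], x, rfl, rfl, h⟩

theorem exists_isPatternUnion_acceptsFrom [Fintype α] {q : σ} (S : Finset σ)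
    (hcomm : ∀ z, (∃ y, y ∈ M.acceptsFrom (M.evalFrom q z)) → ∀ u v,
      M.evalFrom (M.evalFrom q z) u = M.evalFrom q z →
      M.evalFrom (M.evalFrom q z) v = M.evalFrom q z → u ++ v = v ++ u) :
    ∃ K : Language α, IsPatternUnion K ∧ K ≤ M.acceptsFrom q ∧
      ∀ x ∈ M.acceptsFrom q, (∀ p, p <+: x → M.evalFrom q p ∈ S) → x ∈ K := by
  classical
  induction S using Finset.strongInduction generalizing q with
  | H S ih =>
    by_cases hq : q ∈ S ∧ ∃ y, y ∈ M.acceptsFrom q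
    swap
    · exact ⟨0, .zero, fun x hx => (Language.notMem_zero x hx).elim,
        fun x hx hS => (hq ⟨hS [] List.nil_prefix, x, hx⟩).elim⟩
    obtain ⟨hqS, hq⟩ := hq
    obtain ⟨w, hw, hloop⟩ := M.exists_forall_loop_eq_wordPow (q := q) (hcomm [] hq)
    choose K hK hKle hKmem using fun a : α => ih (S.erase q) (Finset.erase_ssubset hqS)
      (q := M.step q a) fun z => hcomm (a :: z)
    let E : Language α := if q ∈ M.accept then {[]} else 0
    have hE : IsPatternUnion E := by
      by_cases h : q ∈ M.accept
      · simpa [E, h] using (IsPattern.singleton []).isPatternUnion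
      · simpa [E, h] using IsPatternUnion.zero
    refine ⟨({w} : Language α)∗ * (E + ∑ a, {[a]} * K a), ?_, ?_, ?_⟩
    · exact (hE.add (.sum _ fun a => (hK a).mul_left fun P hP => hP.singleton_mul _)).kstar_mul w
    · intro x hx
      obtain ⟨u, hu, y, hy, rfl⟩ := Language.mem_mul.1 hx
      change M.evalFrom q (u ++ y) ∈ M.accept
      rw [evalFrom_of_append, M.evalFrom_of_pow hw hu]
      rcases (Language.mem_add _ _ _).1 hy with hy | hy
      · by_cases h : q ∈ M.accept
        · simp only [E, h, if_true] at hy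
          obtain rfl : y = [] := hy
          exact h
        · simp only [E, h, if_false] at hy
          exact (Language.notMem_zero y hy).elim
      · obtain ⟨a, -, hy⟩ := Language.mem_sum.1 hy
        obtain ⟨_, rfl, t, ht, rfl⟩ := Language.mem_mul.1 hy
        exact hKle a ht
    · intro x hx hS
      obtain ⟨u, y, rfl, hu, hy⟩ := M.exists_eq_append_last_visit q x
      rw [mem_acceptsFrom, evalFrom_of_append, hu] at hx
      refine Language.mem_mul.2 ⟨u, mem_kstar_singleton.2 (hloop u hu), y, ?_, rfl⟩
      rw [Language.mem_add]
      cases y with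
      | nil =>
        left
        simp only [evalFrom_nil] at hx
        simp only [E, hx, if_true]
        rfl
      | cons a y =>
        right
        refine Language.mem_sum.2 ⟨a, Finset.mem_univ a, Language.mem_mul.2
          ⟨[a], rfl, y, hKmem a y hx fun p hp => Finset.mem_erase.2 ⟨?_, ?_⟩, rfl⟩⟩
        · exact hy (a :: p) ((List.prefix_cons_inj a).2 hp) (List.cons_ne_nil a p)
        · have h := hS (u ++ a :: p)
            ((List.prefix_append_right_inj u).2 ((List.prefix_cons_inj a).2 hp))
          rwa [evalFrom_of_append, hu] at h

theorem evalFrom_of_mem_kstar_pair {q : σ} {u v : List α} (hu : M.evalFrom q u = q)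
    (hv : M.evalFrom q v = q) {z : List α} (hz : z ∈ ({u, v} : Language α)∗) :
    M.evalFrom q z = q := by
  obtain ⟨S, rfl, hS⟩ := Language.mem_kstar.1 hz
  clear hz
  induction S with
  | nil => rfl
  | cons a S ih =>
    rw [List.flatten_cons, evalFrom_of_append]
    have ha : M.evalFrom q a = q := by
      rcases hS a List.mem_cons_self with rfl | rfl
      exacts [hu, hv]
    rw [ha]
    exact ih fun y hy => hS y (List.mem_cons_of_mem a hy)

theorem isPatternUnion_accepts [Fintype α] [Fintype σ] (h : IsSparseLang M.accepts) :
    IsPatternUnion M.accepts := by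
  obtain ⟨K, hK, hle, hmem⟩ := M.exists_isPatternUnion_acceptsFrom (q := M.start) Finset.univ
    fun x ⟨y, hy⟩ u v hu hv => h.append_comm (x := x) (y := y) fun z hz => by
      rw [mem_accepts, eval, evalFrom_of_append, evalFrom_of_append,
        M.evalFrom_of_mem_kstar_pair hu hv hz]
      exact hy
  rwa [show M.accepts = K from
    le_antisymm (fun x hx => hmem x hx fun _ _ => Finset.mem_univ _) hle]

end DFA

/-- A regular language over a finite alphabet is sparse if and only if it is a
finite union of languages of the form `v₁ w₁* v₂ w₂* ⋯ v_s w_s* v_{s+1}` with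
the `v_i` possibly empty words and the `w_i` nonempty words. -/
theorem sparse_iff_finite_union_of_patterns
    {α : Type} [Fintype α] (L : Language α) (hreg : L.IsRegular) :
    IsSparseLang L ↔
      ∃ (m : ℕ) (f : Fin m → Language α),
        (∀ j, ∃ (s : ℕ) (v w : ℕ → List α),
          (∀ i, 1 ≤ i → i ≤ s → w i ≠ []) ∧ f j = patternLang s v w) ∧
        L = ⋃ j, f j := by
  have hunion : ∀ (m : ℕ) (f : Fin m → Language α),
      (L = ⋃ j, f j) ↔ ∀ x, x ∈ L ↔ ∃ j, x ∈ f j := fun m f =>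
    Set.ext_iff.trans (forall_congr' fun x => iff_congr Iff.rfl Set.mem_iUnion)
  simp only [hunion]
  refine Iff.trans ⟨fun h => ?_, IsPatternUnion.isSparseLang⟩ isPatternUnion_iff
  obtain ⟨σ, _, M, rfl⟩ := hreg
  exact M.isPatternUnion_accepts h
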